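/- arXiv:2101.02133 — 4 statements merged into one kernel-verified Lean document; each statement's English description precedes it below -/
import Mathlib

section
/- The Kerov R-matrix R is a self-adjoint bounded operator on ℓ²(S × S; ℂ) and satisfies the Iwahori–Hecke quadratic relation R ∘ R = (q − 1)·R + q·Id, equivalently (R + Id) ∘ (R − q·Id) = 0. -/
/-!
STATEMENT 0: The Kerov R-matrix `R` on `ℓ²(S × S; ℂ)` (where `S` is the set of nonzero
integers) is a self-adjoint bounded operator satisfying the Iwahori–Hecke quadratic relation
`R ∘ R = (q − 1)·R + q·Id`, equivalently `(R + Id) ∘ (R − q·Id) = 0`.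
-/

noncomputable section

/-- The set of nonzero integers. -/
abbrev Sz : Type := {i : ℤ // i ≠ 0}

/-- The Hilbert space `ℓ²(S × S; ℂ)`. -/
abbrev H0 : Type := lp (fun _ : Sz × Sz => ℂ) 2

/-- Canonical orthonormal basis vectors of `ℓ²(S × S; ℂ)`. -/
def e0 (p : Sz × Sz) : H0 := lp.single 2 p (1 : ℂ)

/-- The defining rules of the Kerov R-matrix on the canonical orthonormal basis. -/
def KerovRules (q : ℝ) (R : H0 →L[ℂ] H0) : Prop :=
  (∀ i : Sz, (i : ℤ) < 0 → R (e0 (i, i)) = - e0 (i, i)) ∧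
  (∀ i : Sz, 0 < (i : ℤ) → R (e0 (i, i)) = (q : ℂ) • e0 (i, i)) ∧
  (∀ i j : Sz, (j : ℤ) < (i : ℤ) → R (e0 (i, j)) = -((Real.sqrt q : ℂ) • e0 (j, i))) ∧
  (∀ i j : Sz, (i : ℤ) < (j : ℤ) →
    R (e0 (i, j)) = -((Real.sqrt q : ℂ) • e0 (j, i)) + ((q : ℂ) - 1) • e0 (i, j))


def aK (q : ℝ) (p : Sz × Sz) : ℝ :=
  if p.1 = p.2 then (if (p.1 : ℤ) < 0 then -1 else q)
  else if (p.1 : ℤ) < p.2 then q - 1 else 0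

def bK (q : ℝ) (p : Sz × Sz) : ℝ := if p.1 = p.2 then 0 else -Real.sqrt q

theorem wt_mem (a : Sz × Sz → ℝ) (C : ℝ) (ha : ∀ p, |a p| ≤ C)
    (σ : Sz × Sz ≃ Sz × Sz) (f : H0) :
    Memℓp (fun p => (a p : ℂ) * f (σ p)) 2 ∧
    ∑' p, ‖(a p : ℂ) * f (σ p)‖ ^ (2:ℝ) ≤ (C * ‖f‖) ^ (2:ℝ) := by
  have hC : 0 ≤ C := (abs_nonneg _).trans (ha (⟨1, one_ne_zero⟩, ⟨1, one_ne_zero⟩))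
  have h2 : (0:ℝ) < (2 : ENNReal).toReal := by norm_num
  have hs : Summable fun p => ‖f p‖ ^ (2:ℝ) := by
    simpa using (lp.memℓp f).summable h2
  have hn : ‖f‖ ^ (2:ℝ) = ∑' p, ‖f p‖ ^ (2:ℝ) := by
    simpa using lp.norm_rpow_eq_tsum h2 f
  have hs' : Summable fun p => C ^ (2:ℝ) * ‖f (σ p)‖ ^ (2:ℝ) :=
    ((σ.summable_iff (f := fun p => ‖f p‖ ^ (2:ℝ))).2 hs).mul_left _
  have hle : ∀ p, ‖(a p : ℂ) * f (σ p)‖ ^ (2:ℝ) ≤ C ^ (2:ℝ) * ‖f (σ p)‖ ^ (2:ℝ) := by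
    intro p
    rw [norm_mul, Real.mul_rpow (norm_nonneg _) (norm_nonneg _)]
    gcongr
    simpa using ha p
  have hs3 : Summable fun p => ‖(a p : ℂ) * f (σ p)‖ ^ (2:ℝ) :=
    Summable.of_nonneg_of_le (fun p => by positivity) hle hs'
  refine ⟨memℓp_gen (by simpa using hs3), ?_⟩
  refine (hs3.tsum_le_tsum hle hs').trans ?_
  rw [tsum_mul_left, Real.mul_rpow hC (norm_nonneg _), hn,
    σ.tsum_eq (fun p => ‖f p‖ ^ (2:ℝ))]

def wtOp (a : Sz × Sz → ℝ) (C : ℝ) (ha : ∀ p, |a p| ≤ C)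
    (σ : Sz × Sz ≃ Sz × Sz) : H0 →L[ℂ] H0 :=
  LinearMap.mkContinuous
    { toFun := fun f => ⟨fun p => (a p : ℂ) * f (σ p), (wt_mem a C ha σ f).1⟩
      map_add' := by
        intro f g
        ext p
        exact mul_add _ _ _
      map_smul' := by
        intro c f
        ext p
        simp [mul_left_comm] } C (by
    intro f
    have hC : 0 ≤ C := (abs_nonneg _).trans (ha (⟨1, one_ne_zero⟩, ⟨1, one_ne_zero⟩))
    refine lp.norm_le_of_tsum_le (by norm_num) (by positivity) ?_
    simpa using (wt_mem a C ha σ f).2)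

theorem wtOp_apply (a : Sz × Sz → ℝ) (C : ℝ) (ha : ∀ p, |a p| ≤ C)
    (σ : Sz × Sz ≃ Sz × Sz) (f : H0) (p : Sz × Sz) :
    wtOp a C ha σ f p = (a p : ℂ) * f (σ p) := rfl

theorem e0_apply (p s : Sz × Sz) : e0 p s = if s = p then 1 else 0 := by
  simp [e0, lp.single_apply, Pi.single_apply]

theorem rules_iff (q : ℝ) (R : H0 →L[ℂ] H0) :
    KerovRules q R ↔
      ∀ p, R (e0 p) = (aK q p : ℂ) • e0 p + (bK q p : ℂ) • e0 p.swap := by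
  constructor
  · rintro ⟨h1, h2, h3, h4⟩ ⟨i, j⟩
    rcases lt_trichotomy (i : ℤ) j with h | h | h
    · have : i ≠ j := fun e => by simp [e] at h
      rw [h4 i j h]
      simp [aK, bK, this, h, -Subtype.coe_lt_coe, add_comm]
    · obtain rfl := Subtype.ext h
      rcases lt_or_gt_of_ne i.2 with h | h
      · simp [h1 i h, aK, bK, h]
      · simp [h2 i h, aK, bK, h.le.not_gt]
    · have : i ≠ j := fun e => by simp [e] at h
      rw [h3 i j h]
      simp [aK, bK, this, h.le.not_gt, -Subtype.coe_lt_coe, -not_lt]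
  · intro H
    refine ⟨fun i h => ?_, fun i h => ?_, fun i j h => ?_, fun i j h => ?_⟩
    · simp [H, aK, bK, h]
    · simp [H, aK, bK, h.le.not_gt]
    · have : i ≠ j := fun e => by simp [e] at h
      simp [H, aK, bK, this, h.le.not_gt, -Subtype.coe_lt_coe, -not_lt]
    · have : i ≠ j := fun e => by simp [e] at h
      simp [H, aK, bK, this, h, -Subtype.coe_lt_coe, add_comm]

theorem bK_swap (q : ℝ) (p : Sz × Sz) : bK q p.swap = bK q p := by
  simp [bK, eq_comm]

theorem ext_e0 {A B : H0 →L[ℂ] H0} (h : ∀ p, A (e0 p) = B (e0 p)) : A = B := by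
  refine lp.ext_continuousLinearMap (by norm_num) fun p => ?_
  ext
  simpa [e0] using congrArg (fun v : H0 => v _) (h p)

theorem aK_bd (q : ℝ) (hq : 0 < q) (p) : |aK q p| ≤ q + 1 := by
  unfold aK
  split_ifs <;> rw [abs_le] <;> constructor <;> linarith

theorem bK_bd (q : ℝ) (p) : |bK q p| ≤ Real.sqrt q := by
  unfold bK
  split_ifs <;> simp [abs_of_nonneg (Real.sqrt_nonneg q)]

theorem diag_rel (q : ℝ) (hq : 0 < q) (p : Sz × Sz) :
    aK q p * aK q p + bK q p * bK q p = (q - 1) * aK q p + q := by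
  have := Real.mul_self_sqrt hq.le
  unfold aK bK
  split_ifs <;> linarith

theorem off_rel (q : ℝ) (p : Sz × Sz) :
    bK q p * (aK q p + aK q p.swap) = (q - 1) * bK q p := by
  obtain ⟨i, j⟩ := p
  by_cases hij : i = j
  · simp [bK, hij]
  · have hne : (i : ℤ) ≠ j := fun h => hij (Subtype.ext h)
    have hji : j ≠ i := Ne.symm hij
    rcases lt_or_gt_of_ne hne with h | h
    · simp [aK, hij, hji, h, h.le.not_gt, -Subtype.coe_lt_coe, -not_lt, mul_comm]
    · simp [aK, hij, hji, h, h.le.not_gt, -Subtype.coe_lt_coe, -not_lt, mul_comm]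

theorem kerov_R_selfAdjoint_and_quadratic (q : ℝ) (hq : 0 < q) :
    (∃ R : H0 →L[ℂ] H0, KerovRules q R) ∧
    (∀ R : H0 →L[ℂ] H0, KerovRules q R →
      IsSelfAdjoint R ∧
      R.comp R = ((q : ℂ) - 1) • R + (q : ℂ) • (1 : H0 →L[ℂ] H0) ∧
      (R + 1).comp (R - (q : ℂ) • (1 : H0 →L[ℂ] H0)) = 0) := by
  constructor
  · refine ⟨wtOp (aK q) _ (aK_bd q hq) (Equiv.refl _) +
      wtOp (bK q) _ (bK_bd q) (Equiv.prodComm _ _), (rules_iff _ _).2 fun p => ?_⟩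
    ext s
    have hsw : (s.swap = p) ↔ s = p.swap := by
      constructor <;> rintro rfl <;> simp
    simp only [ContinuousLinearMap.add_apply, lp.coeFn_add, Pi.add_apply, wtOp_apply,
      lp.coeFn_smul, Pi.smul_apply, smul_eq_mul, e0_apply, Equiv.refl_apply,
      Equiv.prodComm_apply, hsw]
    congr 1
    · split_ifs with h
      · rw [h]
      · simp
    · split_ifs with h
      · rw [h, bK_swap]
      · simp
  · intro R hR
    have H := (rules_iff _ _).1 hR
    have hquad : R.comp R = ((q : ℂ) - 1) • R + (q : ℂ) • (1 : H0 →L[ℂ] H0) := by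
      refine ext_e0 fun p => ?_
      have hd : (aK q p : ℂ) * aK q p + bK q p * bK q p = (q - 1) * aK q p + q := by
        exact_mod_cast diag_rel q hq p
      have ho : (bK q p : ℂ) * (aK q p + aK q p.swap) = (q - 1) * bK q p := by
        exact_mod_cast off_rel q p
      simp only [ContinuousLinearMap.comp_apply, H, map_add, map_smul, bK_swap,
        Prod.swap_swap, ContinuousLinearMap.add_apply, ContinuousLinearMap.smul_apply,
        ContinuousLinearMap.one_apply]
      match_scalars
      · linear_combination hd
      · linear_combination ho
    refine ⟨?_, hquad, ?_⟩
    · rw [ContinuousLinearMap.isSelfAdjoint_iff']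
      refine ext_e0 fun p => ?_
      ext s
      have key : ∀ x : H0, x s = inner ℂ (e0 s) x := fun x => by
        simp [e0, lp.inner_single_left]
      have key2 : ∀ x : H0, inner ℂ x (e0 p) = (starRingEnd ℂ) (x p) := fun x => by
        simp [e0, lp.inner_single_right]
      rw [key, ContinuousLinearMap.adjoint_inner_right, key2, H, H]
      have hsw : (p = s.swap) ↔ s = p.swap := by
        constructor <;> rintro rfl <;> simp
      simp only [lp.coeFn_add, Pi.add_apply,
        lp.coeFn_smul, Pi.smul_apply, smul_eq_mul, e0_apply, hsw, map_add, map_mul,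
        Complex.conj_ofReal, eq_comm (a := p)]
      congr 1
      · split_ifs with h
        · simp [h]
        · simp
      · split_ifs with h
        · simp [h, bK_swap]
        · simp
    · have : (R + 1).comp (R - (q : ℂ) • (1 : H0 →L[ℂ] H0)) =
          R.comp R - (((q : ℂ) - 1) • R + (q : ℂ) • (1 : H0 →L[ℂ] H0)) := by
        ext1 x
        simp only [ContinuousLinearMap.comp_apply, ContinuousLinearMap.add_apply,
          ContinuousLinearMap.sub_apply, ContinuousLinearMap.smul_apply,
          ContinuousLinearMap.one_apply, map_sub, map_smul]
        module
      rw [this, hquad, sub_self]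
end
end

section
/- For n ≥ 2 and 1 ≤ k ≤ n − 1 let R_k be the bounded operator on ℓ²(S^n; ℂ) that acts by the Kerov R-matrix on the k-th and (k+1)-th coordinates of the tuple and as the identity on the remaining coordinates. Then: (i) R_k ∘ R_k = (q − 1)·R_k + q·Id for all k; (ii) R_k ∘ R_{k+1} ∘ R_k = R_{k+1} ∘ R_k ∘ R_{k+1} for 1 ≤ k ≤ n − 2; (iii) R_k ∘ R_l = R_l ∘ R_k whenever |k − l| > 1. Hence σ_k ↦ R_k satisfies the defining relations of the Iwahori–Hecke algebra H_n(q). -/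
/-!
STATEMENT 1: The operators `R_k` on `ℓ²(S^n; ℂ)` acting by the Kerov R-matrix on the `k`-th
and `(k+1)`-th coordinates satisfy the defining relations of the Iwahori–Hecke algebra
`H_n(q)`: the quadratic relation, the braid relation, and far commutativity.
(Here the operators are indexed by `k = 0, …, n−2`, `R k` acting on coordinates `k, k+1`
of the tuple in `0`-based numbering, i.e. the paper's `R_{k+1}`.)
-/

noncomputable section

/-- The Hilbert space `ℓ²(S^n; ℂ)`. -/
abbrev Hn (n : ℕ) : Type := lp (fun _ : Fin n → Sz => ℂ) 2

/-- Canonical orthonormal basis vectors of `ℓ²(S^n; ℂ)`. -/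
def en {n : ℕ} (I : Fin n → Sz) : Hn n := lp.single 2 I (1 : ℂ)

/-- The tuple `I` with its entries at positions `p` and `p'` interchanged. -/
def swapAt {n : ℕ} (I : Fin n → Sz) (p p' : Fin n) : Fin n → Sz :=
  Function.update (Function.update I p (I p')) p' (I p)

/-- `R` acts on basis vectors `e_I` by the Kerov R-matrix rules applied to the pair
`(I_k, I_{k+1})`, leaving the remaining coordinates unchanged. -/
def KerovRuleAt (n : ℕ) (q : ℝ) (k : ℕ) (hk : k + 1 < n) (R : Hn n →L[ℂ] Hn n) : Prop :=
  ∀ I : Fin n → Sz,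
    ((I ⟨k, Nat.lt_of_succ_lt hk⟩ : ℤ) = (I ⟨k + 1, hk⟩ : ℤ) →
      (((I ⟨k, Nat.lt_of_succ_lt hk⟩ : ℤ) < 0 → R (en I) = - en I) ∧
       (0 < (I ⟨k, Nat.lt_of_succ_lt hk⟩ : ℤ) → R (en I) = (q : ℂ) • en I))) ∧
    ((I ⟨k + 1, hk⟩ : ℤ) < (I ⟨k, Nat.lt_of_succ_lt hk⟩ : ℤ) →
      R (en I) = -((Real.sqrt q : ℂ) •
        en (swapAt I ⟨k, Nat.lt_of_succ_lt hk⟩ ⟨k + 1, hk⟩))) ∧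
    ((I ⟨k, Nat.lt_of_succ_lt hk⟩ : ℤ) < (I ⟨k + 1, hk⟩ : ℤ) →
      R (en I) = -((Real.sqrt q : ℂ) •
        en (swapAt I ⟨k, Nat.lt_of_succ_lt hk⟩ ⟨k + 1, hk⟩)) + ((q : ℂ) - 1) • en I)

/-- Diagonal coefficient. -/
def ka (q : ℝ) (x y : Sz) : ℂ :=
  if (x : ℤ) = y then (if (x : ℤ) < 0 then -1 else (q : ℂ))
  else if (y : ℤ) < x then 0 else (q : ℂ) - 1

/-- Off-diagonal coefficient. -/
def kb (q : ℝ) (x y : Sz) : ℂ :=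
  if (x : ℤ) = y then 0 else -(Real.sqrt q : ℂ)

lemma swapAt_eq {n : ℕ} (I : Fin n → Sz) (p p' : Fin n) :
    swapAt I p p' = fun i => I (Equiv.swap p p' i) := by
  funext i
  simp only [swapAt, Function.update_apply, Equiv.swap_apply_def]
  split_ifs <;> simp_all

lemma rule_eq {n : ℕ} {q : ℝ} {k : ℕ} {hk : k + 1 < n} {R : Hn n →L[ℂ] Hn n}
    (h : KerovRuleAt n q k hk R) (I : Fin n → Sz) :
    R (en I) = ka q (I ⟨k, Nat.lt_of_succ_lt hk⟩) (I ⟨k + 1, hk⟩) • en I +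
      kb q (I ⟨k, Nat.lt_of_succ_lt hk⟩) (I ⟨k + 1, hk⟩) •
        en (fun i => I (Equiv.swap ⟨k, Nat.lt_of_succ_lt hk⟩ ⟨k + 1, hk⟩ i)) := by
  obtain ⟨h1, h2, h3⟩ := h I
  rw [swapAt_eq] at h2 h3
  have hne := (I ⟨k, Nat.lt_of_succ_lt hk⟩).2
  unfold ka kb
  rcases lt_trichotomy (I ⟨k, Nat.lt_of_succ_lt hk⟩ : ℤ) (I ⟨k + 1, hk⟩ : ℤ) with c | c | c
  · rw [h3 c, if_neg c.ne, if_neg c.not_gt, if_neg c.ne]; module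
  · rcases lt_or_gt_of_ne hne with d | d
    · rw [(h1 c).1 d, if_pos c, if_pos d, if_pos c]; module
    · rw [(h1 c).2 d, if_pos c, if_neg d.not_gt, if_pos c]; module
  · rw [h2 c, if_neg c.ne', if_pos c, if_neg c.ne']; module

lemma clm_ext {n : ℕ} {A B : Hn n →L[ℂ] Hn n} (h : ∀ I, A (en I) = B (en I)) : A = B := by
  refine lp.ext_continuousLinearMap (by simp) fun I => ?_
  ext
  have h2 := h I
  unfold en at h2
  simp [h2]

lemma sqrt_sq' {q : ℝ} (hq : 0 < q) : (Real.sqrt q : ℂ) * (Real.sqrt q : ℂ) = (q : ℂ) := by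
  rw [← Complex.ofReal_mul, Real.mul_self_sqrt hq.le]

set_option maxHeartbeats 2000000 in
theorem kerov_R_hecke_relations (n : ℕ) (hn : 2 ≤ n) (q : ℝ) (hq : 0 < q)
    (R : ℕ → (Hn n →L[ℂ] Hn n))
    (hR : ∀ k (hk : k + 1 < n), KerovRuleAt n q k hk (R k)) :
    (∀ k, k + 1 < n →
      (R k).comp (R k) = ((q : ℂ) - 1) • R k + (q : ℂ) • (1 : Hn n →L[ℂ] Hn n)) ∧
    (∀ k, k + 2 < n →
      (R k).comp ((R (k + 1)).comp (R k)) = (R (k + 1)).comp ((R k).comp (R (k + 1)))) ∧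
    (∀ k l, k + 1 < n → l + 1 < n → (k + 1 < l ∨ l + 1 < k) →
      (R k).comp (R l) = (R l).comp (R k)) := by
  have hs := sqrt_sq' hq
  refine ⟨fun k hk => clm_ext fun I => ?_, fun k hk => clm_ext fun I => ?_,
    fun k l hk hl hkl => clm_ext fun I => ?_⟩
  · have h := rule_eq (hR k hk)
    simp only [ContinuousLinearMap.comp_apply, ContinuousLinearMap.add_apply,
      ContinuousLinearMap.smul_apply, ContinuousLinearMap.one_apply, h, map_add, map_smul,
      Equiv.swap_apply_left, Equiv.swap_apply_right, Equiv.swap_apply_self]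
    generalize I ⟨k, _⟩ = x
    generalize I ⟨k + 1, _⟩ = y
    match_scalars <;> simp only [ka, kb] <;> grind
  · have h1 := rule_eq (hR k (by omega))
    have h2 := rule_eq (hR (k + 1) (by omega))
    have n1 : (⟨k, by omega⟩ : Fin n) ≠ ⟨k + 1, by omega⟩ := by simp
    have n2 : (⟨k, by omega⟩ : Fin n) ≠ ⟨k + 1 + 1, by omega⟩ := by simp; omega
    have n3 : (⟨k + 1, by omega⟩ : Fin n) ≠ ⟨k + 1 + 1, by omega⟩ := by simp
    generalize (⟨k, _⟩ : Fin n) = a at *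
    generalize (⟨k + 1, _⟩ : Fin n) = b at *
    generalize (⟨k + 1 + 1, _⟩ : Fin n) = c at *
    have hbr : ∀ i, Equiv.swap a b (Equiv.swap b c (Equiv.swap a b i)) =
        Equiv.swap b c (Equiv.swap a b (Equiv.swap b c i)) := by
      intro i
      simp only [Equiv.swap_apply_def]
      grind
    have e1 : Equiv.swap a b c = c := Equiv.swap_apply_of_ne_of_ne n2.symm n3.symm
    have e2 : Equiv.swap b c a = a := Equiv.swap_apply_of_ne_of_ne n1 n2
    simp only [ContinuousLinearMap.comp_apply, h1, h2, map_add, map_smul,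
      Equiv.swap_apply_left, Equiv.swap_apply_right, Equiv.swap_apply_self, e1, e2, hbr]
    generalize I a = x
    generalize I b = y
    generalize I c = z
    match_scalars <;> simp only [ka, kb] <;> grind
  · have h1 := rule_eq (hR k hk)
    have h2 := rule_eq (hR l hl)
    have n1 : (⟨k, by omega⟩ : Fin n) ≠ ⟨l, by omega⟩ := by simp; omega
    have n2 : (⟨k, by omega⟩ : Fin n) ≠ ⟨l + 1, by omega⟩ := by simp; omega
    have n3 : (⟨k + 1, by omega⟩ : Fin n) ≠ ⟨l, by omega⟩ := by simp; omega
    have n4 : (⟨k + 1, by omega⟩ : Fin n) ≠ ⟨l + 1, by omega⟩ := by simp; omega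
    generalize (⟨k, _⟩ : Fin n) = a at *
    generalize (⟨k + 1, _⟩ : Fin n) = b at *
    generalize (⟨l, _⟩ : Fin n) = c at *
    generalize (⟨l + 1, _⟩ : Fin n) = d at *
    have hbr : ∀ i, Equiv.swap a b (Equiv.swap c d i) =
        Equiv.swap c d (Equiv.swap a b i) := by
      intro i
      simp only [Equiv.swap_apply_def]
      grind
    have e1 : Equiv.swap a b c = c := Equiv.swap_apply_of_ne_of_ne n1.symm n3.symm
    have e2 : Equiv.swap a b d = d := Equiv.swap_apply_of_ne_of_ne n2.symm n4.symm
    have e3 : Equiv.swap c d a = a := Equiv.swap_apply_of_ne_of_ne n1 n2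
    have e4 : Equiv.swap c d b = b := Equiv.swap_apply_of_ne_of_ne n3 n4
    simp only [ContinuousLinearMap.comp_apply, h1, h2, map_add, map_smul, e1, e2, e3, e4, hbr]
    module
end
end

section
/- Let q > 0 and m ≥ 1, and let i_1 ≤ i_2 ≤ … ≤ i_m be a weakly increasing tuple of nonzero integers. Let u be the number of distinct negative values among the i_k, v the number of distinct positive values, P the number of indices k with i_k < 0, and N the number of indices k with i_k > 0 (so P + N = m and u + v ≥ 1). Then ∏_{k=1}^{m−1} c_q(i_k, i_{k+1}) = (−1)^{P−u} · q^{N−v} · (q−1)^{u+v−1}. Moreover, if a tuple (i_1,…,i_m) ∈ S^m is not weakly increasing, then ∏_{k=1}^{m−1} c_q(i_k, i_{k+1}) = 0. -/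
/-!
STATEMENT 14: For a weakly increasing tuple `i_1 ≤ … ≤ i_m` of nonzero integers,
`∏_{k=1}^{m−1} c_q(i_k, i_{k+1}) = (−1)^{P−u} · q^{N−v} · (q−1)^{u+v−1}`, where `u`/`v` are
the numbers of distinct negative/positive values and `P`/`N` the numbers of negative/positive
entries.  If the tuple is not weakly increasing, the product is `0`.
-/

noncomputable section

/-- The diagonal coefficient `c_q(i,j)`: `−1` if `i = j < 0`, `q` if `i = j > 0`,
`q − 1` if `i < j`, and `0` if `i > j`. -/
def cq (q : ℝ) (i j : Sz) : ℝ :=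
  if (i : ℤ) = (j : ℤ) then (if (i : ℤ) < 0 then -1 else q)
  else if (i : ℤ) < (j : ℤ) then q - 1 else 0

theorem cq_aux (q : ℝ) (J : ℕ → Sz) (n : ℕ)
    (hJ : ∀ k l : ℕ, k ≤ l → l ≤ n → (J k : ℤ) ≤ (J l : ℤ)) (P N u v : ℕ)
    (hP : P = ((Finset.range (n+1)).filter fun k => (J k : ℤ) < 0).card)
    (hN : N = ((Finset.range (n+1)).filter fun k => 0 < (J k : ℤ)).card)
    (hu : u = (((Finset.range (n+1)).image J).filter fun i : Sz => (i : ℤ) < 0).card)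
    (hv : v = (((Finset.range (n+1)).image J).filter fun i : Sz => 0 < (i : ℤ)).card) :
    u ≤ P ∧ v ≤ N ∧ 1 ≤ u + v ∧
    ∏ k ∈ Finset.range n, cq q (J k) (J (k+1)) =
      (-1 : ℝ) ^ (P - u) * q ^ (N - v) * (q - 1) ^ (u + v - 1) := by
  induction n generalizing P N u v with
  | zero =>
    have h0 := (J 0).2
    rcases lt_or_gt_of_ne h0 with h | h
    · have h' : ¬ (0 < (J 0 : ℤ)) := by omega
      simp [Finset.filter_singleton, h, h'] at hP hN hu hv
      subst hP hN hu hv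
      simp
    · have h' : ¬ ((J 0 : ℤ) < 0) := by omega
      simp [Finset.filter_singleton, h, h'] at hP hN hu hv
      subst hP hN hu hv
      simp
  | succ n ih =>
    obtain ⟨h1, h2, h3, h4⟩ := ih (fun k l hk hl => hJ k l hk (by omega)) _ _ _ _ rfl rfl rfl rfl
    rw [Finset.prod_range_succ, h4]
    rw [Finset.range_add_one, Finset.filter_insert] at hP hN
    rw [Finset.range_add_one, Finset.image_insert, Finset.filter_insert] at hu hv
    clear h4
    have hle := hJ n (n+1) (by omega) le_rfl
    have h0 := (J (n+1)).2
    have hnr : n + 1 ∉ Finset.range (n+1) := by simp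
    have key : (J n = J (n+1) ∧ J (n+1) ∈ (Finset.range (n+1)).image J) ∨
        ((J n : ℤ) < (J (n+1) : ℤ) ∧ J (n+1) ∉ (Finset.range (n+1)).image J) := by
      rcases hle.eq_or_lt with h | h
      · left
        have h := Subtype.ext h
        exact ⟨h, Finset.mem_image.2 ⟨n, by simp, h⟩⟩
      · right
        refine ⟨h, fun hm => ?_⟩
        obtain ⟨k, hk, hk'⟩ := Finset.mem_image.1 hm
        have := hJ k n (by simp at hk; omega) (by omega)
        rw [hk'] at this
        omega
    generalize (Finset.range (n+1)).image J = A at *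
    generalize (Finset.range (n+1)) = R at *
    rcases lt_or_gt_of_ne h0 with h | h
    · have h' : ¬ (0 < (J (n+1) : ℤ)) := by omega
      rw [if_pos h, Finset.card_insert_of_notMem (by simp [hnr])] at hP
      rw [if_neg h'] at hN hv
      rw [if_pos h] at hu
      rcases key with ⟨e, hm⟩ | ⟨e, hm⟩
      · rw [Finset.insert_eq_of_mem (by simp [hm, h])] at hu
        rw [← hu] at h1 h3 ⊢
        rw [← hv] at h2 h3 ⊢
        rw [← hN] at h2 ⊢
        refine ⟨by omega, by omega, by omega, ?_⟩
        rw [hP, Nat.sub_add_comm h1, pow_succ]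
        simp only [cq, e, h, if_true]
        ring
      · rw [Finset.card_insert_of_notMem (by simp [hm])] at hu
        rw [← hv] at h2 h3 ⊢
        rw [← hN] at h2 ⊢
        refine ⟨by omega, by omega, by omega, ?_⟩
        rw [hP, hu, Nat.add_sub_add_right, add_right_comm, Nat.sub_add_comm h3, pow_succ]
        simp only [cq, e, e.ne, if_true, if_false]
        ring
    · have h' : ¬ ((J (n+1) : ℤ) < 0) := by omega
      rw [if_pos h, Finset.card_insert_of_notMem (by simp [hnr])] at hN
      rw [if_neg h'] at hP hu
      rw [if_pos h] at hv
      rcases key with ⟨e, hm⟩ | ⟨e, hm⟩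
      · rw [Finset.insert_eq_of_mem (by simp [hm, h])] at hv
        rw [← hu] at h1 h3 ⊢
        rw [← hv] at h2 h3 ⊢
        rw [← hP] at h1 ⊢
        refine ⟨by omega, by omega, by omega, ?_⟩
        rw [hN, Nat.sub_add_comm h2, pow_succ]
        simp only [cq, e, h', if_true, if_false]
        ring
      · rw [Finset.card_insert_of_notMem (by simp [hm])] at hv
        rw [← hu] at h1 h3 ⊢
        rw [← hP] at h1 ⊢
        refine ⟨by omega, by omega, by omega, ?_⟩
        rw [hN, hv, Nat.add_sub_add_right, ← add_assoc, Nat.sub_add_comm h3, pow_succ]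
        simp only [cq, e, e.ne, if_true, if_false]
        ring

theorem cq_product_of_monotone_tuple (q : ℝ) (hq : 0 < q) (m : ℕ) (hm : 1 ≤ m)
    (I : Fin m → Sz) :
    ((∀ k l : Fin m, k ≤ l → (I k : ℤ) ≤ (I l : ℤ)) →
      ∏ k : Fin (m - 1),
          cq q (I ⟨k.1, by have := k.2; omega⟩) (I ⟨k.1 + 1, by have := k.2; omega⟩) =
        (-1 : ℝ) ^ ((Finset.univ.filter fun k : Fin m => (I k : ℤ) < 0).card
              - ((Finset.univ.image I).filter fun i : Sz => (i : ℤ) < 0).card)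
          * q ^ ((Finset.univ.filter fun k : Fin m => 0 < (I k : ℤ)).card
              - ((Finset.univ.image I).filter fun i : Sz => 0 < (i : ℤ)).card)
          * (q - 1) ^ ((((Finset.univ.image I).filter fun i : Sz => (i : ℤ) < 0).card
              + ((Finset.univ.image I).filter fun i : Sz => 0 < (i : ℤ)).card) - 1)) ∧
    (¬ (∀ k l : Fin m, k ≤ l → (I k : ℤ) ≤ (I l : ℤ)) →
      ∏ k : Fin (m - 1),
          cq q (I ⟨k.1, by have := k.2; omega⟩) (I ⟨k.1 + 1, by have := k.2; omega⟩) = 0) := by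
  obtain ⟨n, rfl⟩ : ∃ n, m = n + 1 := ⟨m - 1, by omega⟩
  obtain ⟨J, hJ⟩ : ∃ J : ℕ → Sz, ∀ k : Fin (n+1), I k = J k.1 :=
    ⟨fun k => if h : k < n + 1 then I ⟨k, h⟩ else I 0, fun k => by simp only [k.2, dif_pos]⟩
  have hprod : ∏ k : Fin (n + 1 - 1),
      cq q (I ⟨k.1, by have := k.2; omega⟩) (I ⟨k.1 + 1, by have := k.2; omega⟩) =
      ∏ k ∈ Finset.range n, cq q (J k) (J (k+1)) := by
    simp only [hJ]
    exact Fin.prod_univ_eq_prod_range (fun k => cq q (J k) (J (k+1))) n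
  rw [hprod]
  constructor
  · intro hmono
    refine (cq_aux q J n ?_ _ _ _ _ ?_ ?_ ?_ ?_).2.2.2
    · intro k l hkl hl
      have := hmono ⟨k, by omega⟩ ⟨l, by omega⟩ hkl
      simpa only [hJ] using this
    · simp only [hJ, Finset.card_filter]
      exact Fin.sum_univ_eq_sum_range (fun k => if (J k : ℤ) < 0 then 1 else 0) (n+1)
    · simp only [hJ, Finset.card_filter]
      exact Fin.sum_univ_eq_sum_range (fun k => if 0 < (J k : ℤ) then 1 else 0) (n+1)
    all_goals
      congr 2
      ext x
      simp only [Finset.mem_image, Finset.mem_univ, true_and, Finset.mem_range, hJ]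
      constructor
      · rintro ⟨k, hk⟩
        exact ⟨k.1, k.2, hk⟩
      · rintro ⟨k, h, hk⟩
        exact ⟨⟨k, h⟩, hk⟩
  · intro hn
    by_contra hne
    apply hn
    have hstep : ∀ k, k < n → (J k : ℤ) ≤ (J (k+1) : ℤ) := by
      intro k hk
      have := Finset.prod_ne_zero_iff.1 hne k (by simpa using hk)
      by_contra hlt
      apply this
      unfold cq
      rw [if_neg (by omega), if_neg (by omega)]
    have hm' : ∀ k l : ℕ, k ≤ l → l ≤ n → (J k : ℤ) ≤ (J l : ℤ) := by
      intro k l hkl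
      induction l, hkl using Nat.le_induction with
      | base => intro _; exact le_rfl
      | succ l hl ih => intro h; exact (ih (by omega)).trans (hstep l (by omega))
    intro k l hkl
    rw [hJ, hJ]
    exact hm' k l hkl (by have := l.2; omega)
end
end

section
/- Let q > 0 with q ≠ 1 and m ≥ 1. Then ∑_{(i_1,…,i_m) ∈ S^m} (∏_{k=1}^{m−1} c_q(i_k, i_{k+1})) ∏_{k=1}^{m} a(i_k) = (q−1)^{−1} · ∑_{(φ,ψ)} ( ∏_{i≥1} (−β_i)^{φ_i} (1−q)^{ε(φ_i)} ) · ( ∏_{j≥1} (q·α_j)^{ψ_j} (1−q^{−1})^{ε(ψ_j)} ), where the right-hand sum is over all pairs of finitely supported functions φ, ψ : {1,2,3,…} → ℕ with ∑_i φ_i + ∑_j ψ_j = m, and ε(0) = 0, ε(t) = 1 for t ≥ 1; both sides converge absolutely. -/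
/-!
STATEMENT 15: For `q > 0`, `q ≠ 1`,
`∑_{(i_1,…,i_m) ∈ S^m} (∏_{k=1}^{m−1} c_q(i_k,i_{k+1})) ∏_k a(i_k)
  = (q−1)⁻¹ ∑_{(φ,ψ)} (∏_{i≥1} (−β_i)^{φ_i} (1−q)^{ε(φ_i)}) (∏_{j≥1} (qα_j)^{ψ_j} (1−q^{−1})^{ε(ψ_j)})`,
the sum on the right being over pairs of finitely supported `φ, ψ : {1,2,…} → ℕ` with
`∑φ + ∑ψ = m`; both sides converge absolutely.
(The sequences `α, β` are indexed here by `ℕ = {0,1,2,…}`, index `j` standing for the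
paper's index `j+1`; since `ε(t) = 1` exactly on the support, the infinite products are
rendered as products over the supports of `φ` and `ψ`.)
-/

noncomputable section

/-- The weights `a : S → ℝ`: `a(j) = α_j` for `j > 0` and `a(−i) = β_i` for `i > 0`
(with `α`, `β` indexed by `ℕ`, index `j` standing for the paper's `j+1`). -/
def aOf (α β : ℕ → ℝ) (i : Sz) : ℝ :=
  if 0 < (i : ℤ) then α ((i : ℤ).toNat - 1) else β ((-(i : ℤ)).toNat - 1)

def WL (q : ℝ) (a : Sz → ℝ) : List Sz → ℝ
  | [] => 1
  | [x] => a x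
  | x :: y :: l => cq q x y * a x * WL q a (y :: l)

def hW (q : ℝ) (a : Sz → ℝ) (x : Sz) (t : ℕ) : ℝ :=
  if (x : ℤ) < 0 then (-(a x)) ^ t * (1 - q) else (q * a x) ^ t * (1 - q⁻¹)

lemma hW_one (q : ℝ) (hq : 0 < q) (a : Sz → ℝ) (x : Sz) : hW q a x 1 = (q - 1) * a x := by
  unfold hW
  split_ifs
  · ring
  · field_simp

lemma hW_succ (q : ℝ) (a : Sz → ℝ) (x : Sz) (t : ℕ) :
    hW q a x (t + 1) = cq q x x * a x * hW q a x t := by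
  unfold hW cq
  rw [if_pos rfl]
  split_ifs <;> ring

lemma WL_sorted (q : ℝ) (hq : 0 < q) (a : Sz → ℝ) : ∀ (l : List Sz) (x : Sz),
    (x :: l).Pairwise (· ≤ ·) →
    (q - 1) * WL q a (x :: l) = ∏ z ∈ (x :: l).toFinset, hW q a z ((x :: l).count z)
  | [], x, _ => by simp [WL, hW_one q hq]
  | y :: l, x, h => by
    have ih := WL_sorted q hq a l y (List.pairwise_cons.1 h).2
    rw [WL]
    by_cases hxy : x = y
    · subst hxy
      have hmem : x ∈ (x :: l).toFinset := by simp
      have e : (x :: x :: l).toFinset = (x :: l).toFinset := by simp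
      rw [e, ← Finset.mul_prod_erase _ _ hmem]
      rw [← Finset.mul_prod_erase _ _ hmem] at ih
      have e2 : ∏ z ∈ (x :: l).toFinset.erase x, hW q a z ((x :: x :: l).count z)
          = ∏ z ∈ (x :: l).toFinset.erase x, hW q a z ((x :: l).count z) := by
        refine Finset.prod_congr rfl fun z hz => ?_
        have hz' := (Finset.mem_erase.1 hz).1
        rw [List.count_cons_of_ne (Ne.symm hz')]
      rw [e2, List.count_cons_self (l := x :: l), hW_succ]
      linear_combination (cq q x x * a x) * ih
    · have hlt : ∀ z ∈ y :: l, x < z := by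
        intro z hz
        have hxy' : x < y := lt_of_le_of_ne ((List.pairwise_cons.1 h).1 y (by simp)) hxy
        rcases List.mem_cons.1 hz with rfl | hz
        · exact hxy'
        · exact hxy'.trans_le ((List.pairwise_cons.1 (List.pairwise_cons.1 h).2).1 z hz)
      have hn : x ∉ y :: l := fun hm => lt_irrefl _ (hlt x hm)
      have hc : cq q x y = q - 1 := by
        have h1 : (x : ℤ) < y := hlt y (by simp)
        unfold cq
        rw [if_neg h1.ne, if_pos h1]
      rw [List.toFinset_cons, Finset.prod_insert (by simpa using hn), List.count_cons_self,
        List.count_eq_zero_of_not_mem hn, hW_one q hq, hc]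
      have e2 : ∏ z ∈ (y :: l).toFinset, hW q a z ((x :: y :: l).count z)
          = ∏ z ∈ (y :: l).toFinset, hW q a z ((y :: l).count z) := by
        refine Finset.prod_congr rfl fun z hz => ?_
        rw [List.count_cons_of_ne]
        exact (hlt z (by simpa using hz)).ne
      rw [e2, ← ih]
      ring

lemma WL_ne_zero (q : ℝ) (a : Sz → ℝ) : ∀ (l : List Sz), WL q a l ≠ 0 → l.IsChain (· ≤ ·)
  | [], _ => by simp
  | [x], _ => by simp
  | x :: y :: l, h => by
    rw [WL] at h
    have h1 := right_ne_zero_of_mul h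
    have h2 := left_ne_zero_of_mul (left_ne_zero_of_mul h)
    refine List.isChain_cons_cons.2 ⟨?_, WL_ne_zero q a _ h1⟩
    by_contra hlt
    apply h2
    have hlt' : (y : ℤ) < x := not_le.1 hlt
    unfold cq
    rw [if_neg hlt'.ne', if_neg hlt'.not_gt]

lemma WL_ofFn (q : ℝ) (a : Sz → ℝ) : ∀ (n : ℕ) (I : Fin (n + 1) → Sz),
    (∏ k : Fin n, cq q (I k.castSucc) (I k.succ)) * ∏ k, a (I k) = WL q a (List.ofFn I)
  | 0, I => by simp [WL]
  | n + 1, I => by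
    have ih := WL_ofFn q a n (fun k => I k.succ)
    rw [List.ofFn_succ, List.ofFn_succ, WL]
    rw [List.ofFn_succ] at ih
    rw [← ih, Fin.prod_univ_succ, Fin.prod_univ_succ (n := n + 1)]
    simp only [Fin.castSucc_zero, Fin.succ_castSucc]
    ring

lemma summable_pi_prod {S : Type*} (a : S → ℝ) (ha : ∀ x, 0 ≤ a x) (hs : Summable a) :
    ∀ n : ℕ, Summable (fun I : Fin n → S => ∏ k, a (I k))
  | 0 => Summable.of_finite
  | n + 1 => by
    have ih := summable_pi_prod a ha hs n
    rw [← (Fin.consEquiv (fun _ => S)).summable_iff]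
    have := hs.mul_of_nonneg ih ha (fun I => Finset.prod_nonneg fun k _ => ha _)
    refine this.congr fun p => ?_
    simp [Fin.prod_univ_succ, Fin.consEquiv]

def eSz : ℕ ⊕ ℕ ≃ Sz where
  toFun := Sum.elim (fun i => ⟨-(i + 1 : ℤ), by omega⟩) (fun j => ⟨(j + 1 : ℤ), by omega⟩)
  invFun x := if 0 < (x : ℤ) then Sum.inr ((x : ℤ).toNat - 1) else Sum.inl ((-(x : ℤ)).toNat - 1)
  left_inv x := by
    rcases x with i | j
    · have h : ¬ (0 : ℤ) < -(i + 1 : ℤ) := by omega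
      refine (if_neg h).trans (congrArg Sum.inl ?_)
      change (-(-(i + 1 : ℤ))).toNat - 1 = i
      omega
    · have h : (0 : ℤ) < (j + 1 : ℤ) := by omega
      refine (if_pos h).trans (congrArg Sum.inr ?_)
      change ((j + 1 : ℤ)).toNat - 1 = j
      omega
  right_inv x := by
    obtain ⟨x, hx⟩ := x
    by_cases h : 0 < x
    · simp only [h, if_true, Sum.elim_inr]
      apply Subtype.ext
      simp only
      omega
    · simp only [h, if_false, Sum.elim_inl]
      apply Subtype.ext
      simp only
      omega

lemma aOf_inl (α β : ℕ → ℝ) (i : ℕ) : aOf α β (eSz (Sum.inl i)) = β i := by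
  have h : ¬ (0 : ℤ) < -(i + 1 : ℤ) := by omega
  refine (if_neg h).trans (congrArg β ?_)
  change (-(-(i + 1 : ℤ))).toNat - 1 = i
  omega

lemma aOf_inr (α β : ℕ → ℝ) (i : ℕ) : aOf α β (eSz (Sum.inr i)) = α i := by
  have h : (0 : ℤ) < (i + 1 : ℤ) := by omega
  refine (if_pos h).trans (congrArg α ?_)
  change ((i + 1 : ℤ)).toNat - 1 = i
  omega

def ESz : (ℕ →₀ ℕ) × (ℕ →₀ ℕ) ≃ Multiset Sz :=
  (Finsupp.sumFinsuppEquivProdFinsupp.symm.trans (Finsupp.equivCongrLeft eSz)).trans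
    Multiset.toFinsupp.symm.toEquiv

lemma ESz_toFinsupp (p : (ℕ →₀ ℕ) × (ℕ →₀ ℕ)) :
    Multiset.toFinsupp (ESz p) = Finsupp.equivMapDomain eSz (Finsupp.sumElim p.1 p.2) := by
  simp [ESz, Finsupp.sumFinsuppEquivProdFinsupp]

lemma ESz_prod {N : Type*} [CommMonoid N] (p : (ℕ →₀ ℕ) × (ℕ →₀ ℕ)) (h : Sz → ℕ → N) :
    (Multiset.toFinsupp (ESz p)).prod h
      = (p.1.prod fun i t => h (eSz (Sum.inl i)) t) * (p.2.prod fun i t => h (eSz (Sum.inr i)) t) := by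
  rw [ESz_toFinsupp, Finsupp.prod_equivMapDomain, Finsupp.prod_sumElim]
  rfl

lemma ESz_card (p : (ℕ →₀ ℕ) × (ℕ →₀ ℕ)) :
    Multiset.card (ESz p) = p.1.sum (fun _ t => t) + p.2.sum (fun _ t => t) := by
  have h := ESz_prod (N := Multiplicative ℕ) p (fun _ t => Multiplicative.ofAdd t)
  rw [← Multiset.toFinsupp_sum_eq]
  exact congrArg Multiplicative.toAdd h

lemma exists_ofFn {S : Type*} (m : ℕ) (l : List S) (h : l.length = m) :
    ∃ I : Fin m → S, List.ofFn I = l := by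
  subst h
  exact ⟨l.get, List.ofFn_get l⟩

lemma cq_abs_le (q : ℝ) (hq : 0 < q) (i j : Sz) : |cq q i j| ≤ q + 1 := by
  unfold cq
  split_ifs <;> rw [abs_le] <;> constructor <;> linarith

lemma aOf_summable (α β : ℕ → ℝ) (hαs : Summable α) (hβs : Summable β) :
    Summable (aOf α β) := by
  rw [← eSz.summable_iff]
  apply Summable.sum
  · exact hβs.congr fun i => (aOf_inl α β i).symm
  · exact hαs.congr fun i => (aOf_inr α β i).symm

lemma main_aux (q : ℝ) (hq : 0 < q) (hq1 : q ≠ 1) (n : ℕ)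
    (α β : ℕ → ℝ) (hα : ∀ j, 0 ≤ α j) (hβ : ∀ i, 0 ≤ β i)
    (hαs : Summable α) (hβs : Summable β) (F : (Fin (n + 1) → Sz) → ℝ)
    (hF : ∀ I, F I = (∏ k : Fin n, cq q (I k.castSucc) (I k.succ)) * ∏ k, aOf α β (I k))
    (G : {p : (ℕ →₀ ℕ) × (ℕ →₀ ℕ) //
        p.1.sum (fun _ t => t) + p.2.sum (fun _ t => t) = n + 1} → ℝ)
    (hG : ∀ p, G p = (p.1.1.prod fun i t => (-(β i)) ^ t * (1 - q))
        * (p.1.2.prod fun j t => (q * α j) ^ t * (1 - q⁻¹))) :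
    Summable F ∧ Summable G ∧ ∑' I, F I = (q - 1)⁻¹ * ∑' p, G p := by
  have hq1' : q - 1 ≠ 0 := sub_ne_zero.2 hq1
  have ha : ∀ x, 0 ≤ aOf α β x := by
    intro x
    unfold aOf
    split_ifs
    · exact hα _
    · exact hβ _
  have hFs : Summable F := by
    have h := (summable_pi_prod _ ha (aOf_summable α β hαs hβs) (n + 1)).mul_left ((q + 1) ^ n)
    refine Summable.of_norm_bounded h fun I => ?_
    rw [hF, norm_mul, Real.norm_eq_abs, Real.norm_eq_abs,
      abs_of_nonneg (Finset.prod_nonneg fun k _ => ha _)]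
    refine mul_le_mul_of_nonneg_right ?_ (Finset.prod_nonneg fun k _ => ha _)
    rw [Finset.abs_prod]
    calc _ ≤ ∏ k : Fin n, (q + 1) :=
          Finset.prod_le_prod (fun _ _ => abs_nonneg _) (fun _ _ => cq_abs_le q hq _ _)
      _ = _ := by simp
  have hFW : ∀ I, F I = WL q (aOf α β) (List.ofFn I) := fun I => by rw [hF, WL_ofFn]
  have hex : ∀ p : {p : (ℕ →₀ ℕ) × (ℕ →₀ ℕ) //
        p.1.sum (fun _ t => t) + p.2.sum (fun _ t => t) = n + 1},
      ∃ I : Fin (n + 1) → Sz, List.ofFn I = (ESz p.1).sort (· ≤ ·) := fun p =>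
    exists_ofFn _ _ (by rw [Multiset.length_sort, ESz_card, p.2])
  choose g hg using hex
  have hgm : ∀ p, ((List.ofFn (g p) : List Sz) : Multiset Sz) = ESz p.1 := fun p => by
    rw [hg, Multiset.sort_eq]
  have hinj : Function.Injective g := by
    intro p p' h
    apply Subtype.ext
    apply ESz.injective
    rw [← hgm, ← hgm, h]
  have hGF : ∀ p, G p = (q - 1) * F (g p) := by
    intro p
    have hs : (List.ofFn (g p)).Pairwise (· ≤ ·) := by
      rw [hg]; exact Multiset.pairwise_sort _ _
    have hP := ESz_prod p.1 (hW q (aOf α β))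
    rw [hFW, hG]
    have key : (q - 1) * WL q (aOf α β) (List.ofFn (g p)) =
        ∏ z ∈ (List.ofFn (g p)).toFinset, hW q (aOf α β) z ((List.ofFn (g p)).count z) := by
      rw [List.ofFn_succ] at hs ⊢
      exact WL_sorted q hq _ _ _ hs
    rw [key]
    have e : ∏ z ∈ (List.ofFn (g p)).toFinset, hW q (aOf α β) z ((List.ofFn (g p)).count z)
        = (Multiset.toFinsupp (ESz p.1)).prod (hW q (aOf α β)) := by
      rw [← hgm, Finsupp.prod, Multiset.toFinsupp_support]
      refine Finset.prod_congr ?_ fun z _ => ?_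
      · ext z
        simp
      · rw [Multiset.toFinsupp_apply, Multiset.coe_count]
        congr 1
        unfold List.count
        refine List.countP_congr fun w _ => ?_
        simp only [beq_iff_eq]
    rw [e, hP]
    congr 1
    · refine Finsupp.prod_congr fun i _ => ?_
      unfold hW
      rw [aOf_inl, if_pos]
      simp only [eSz, Equiv.coe_fn_mk, Sum.elim_inl]
      omega
    · refine Finsupp.prod_congr fun i _ => ?_
      unfold hW
      rw [aOf_inr, if_neg]
      simp only [eSz, Equiv.coe_fn_mk, Sum.elim_inr]
      omega
  have hsupp : Function.support F ⊆ Set.range g := by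
    intro I hI
    have hI' : WL q (aOf α β) (List.ofFn I) ≠ 0 := by rw [← hFW]; exact hI
    have hs := (WL_ne_zero _ _ _ hI').pairwise
    have hc : Multiset.card ((List.ofFn I : List Sz) : Multiset Sz) = n + 1 := by simp
    refine ⟨⟨ESz.symm (List.ofFn I : List Sz), ?_⟩, ?_⟩
    · rw [← ESz_card, Equiv.apply_symm_apply, hc]
    · apply List.ofFn_injective
      rw [hg]
      refine List.Perm.eq_of_pairwise' (r := (· ≤ ·)) (Multiset.pairwise_sort _ _) hs ?_
      rw [← Multiset.coe_eq_coe, Multiset.sort_eq, Equiv.apply_symm_apply]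
  refine ⟨hFs, ?_, ?_⟩
  · exact ((hFs.comp_injective hinj).mul_left (q - 1)).congr fun p => (hGF p).symm
  · rw [← hinj.tsum_eq hsupp, tsum_congr hGF, tsum_mul_left, ← mul_assoc, inv_mul_cancel₀ hq1',
      one_mul]

theorem cq_sum_eq_phi_psi_sum (q : ℝ) (hq : 0 < q) (hq1 : q ≠ 1) (m : ℕ) (hm : 1 ≤ m)
    (α β : ℕ → ℝ) (hα : ∀ j, 0 ≤ α j) (hβ : ∀ i, 0 ≤ β i)
    (hαs : Summable α) (hβs : Summable β)
    (hab : ∑' j, α j + ∑' i, β i = 1) :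
    Summable (fun I : Fin m → Sz =>
      (∏ k : Fin (m - 1),
        cq q (I ⟨k.1, by have := k.2; omega⟩) (I ⟨k.1 + 1, by have := k.2; omega⟩))
        * ∏ k, aOf α β (I k)) ∧
    Summable (fun p : {p : (ℕ →₀ ℕ) × (ℕ →₀ ℕ) //
        p.1.sum (fun _ t => t) + p.2.sum (fun _ t => t) = m} =>
      (p.1.1.prod fun i t => (-(β i)) ^ t * (1 - q))
        * (p.1.2.prod fun j t => (q * α j) ^ t * (1 - q⁻¹))) ∧
    (∑' I : Fin m → Sz,
        (∏ k : Fin (m - 1),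
          cq q (I ⟨k.1, by have := k.2; omega⟩) (I ⟨k.1 + 1, by have := k.2; omega⟩))
          * ∏ k, aOf α β (I k))
      = (q - 1)⁻¹ *
        ∑' p : {p : (ℕ →₀ ℕ) × (ℕ →₀ ℕ) //
            p.1.sum (fun _ t => t) + p.2.sum (fun _ t => t) = m},
          (p.1.1.prod fun i t => (-(β i)) ^ t * (1 - q))
            * (p.1.2.prod fun j t => (q * α j) ^ t * (1 - q⁻¹)) := by
  obtain ⟨n, rfl⟩ : ∃ n, m = n + 1 := ⟨m - 1, by omega⟩
  exact main_aux q hq hq1 n α β hα hβ hαs hβs _ (fun I => rfl) _ (fun p => rfl)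
end
end
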